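/- There is no function $\varphi : \mathbb{R}^d \to \mathbb{R}$ which is infinitely differentiable with compact support and satisfies both $\int_{\mathbb{R}^d} \varphi(x)\,dx = 1$ and $\int_{\mathbb{R}^d} x^\alpha \varphi(x)\,dx = 0$ for every multi-index $\alpha \in \mathbb{N}_0^d$ with $|\alpha| \ge 1$. (In particular, the intersection $\bigcap_n \mathcal{B}_n$ of all basic sets is empty.) -/

import Mathlib

open MeasureTheory Filter Topology

/-- Almost every point of `ℝᵈ` has a nonzero `i`-th coordinate. -/
theorem EuclideanSpace.ae_apply_ne_zero {ι : Type*} [Fintype ι] (i : ι) :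
    ∀ᵐ x : EuclideanSpace ℝ ι, x i ≠ 0 := by
  classical
  have hker : (EuclideanSpace.proj i : EuclideanSpace ℝ ι →L[ℝ] ℝ).ker ≠ ⊤ := fun h => by
    have hmem : EuclideanSpace.single i (1 : ℝ) ∈
        (EuclideanSpace.proj i : EuclideanSpace ℝ ι →L[ℝ] ℝ).ker := h ▸ Submodule.mem_top
    simp at hmem
  rw [ae_iff]
  convert Measure.addHaar_submodule volume _ hker using 2
  ext x
  simp

/-- If all positive moments of `φ` in the `i`-th coordinate vanish, then integrating a polynomial
in that coordinate against `φ` evaluates the polynomial at `0`, up to the total mass of `φ`. -/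
theorem integral_polynomial_eval_apply_mul {ι : Type*} [Fintype ι]
    {φ : EuclideanSpace ℝ ι → ℝ} (hc : Continuous φ) (hs : HasCompactSupport φ) (i : ι)
    (hm : ∀ n : ℕ, n ≠ 0 → ∫ x : EuclideanSpace ℝ ι, x i ^ n * φ x = 0) (p : Polynomial ℝ) :
    ∫ x : EuclideanSpace ℝ ι, p.eval (x i) * φ x = p.eval 0 * ∫ x, φ x := by
  have hint (q : Polynomial ℝ) :
      Integrable fun x : EuclideanSpace ℝ ι => q.eval (x i) * φ x :=
    Continuous.integrable_of_hasCompactSupport (by fun_prop) hs.mul_left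
  induction p using Polynomial.induction_on' with
  | add p q hp hq =>
    simp only [Polynomial.eval_add, add_mul]
    rw [integral_add (hint p) (hint q), hp, hq]
  | monomial n a =>
    simp only [Polynomial.eval_monomial, mul_assoc, integral_const_mul]
    rcases eq_or_ne n 0 with rfl | hn
    · simp
    · simp [hm n hn, hn]

/-- A continuous compactly supported function on `ℝᵈ` whose positive moments in one coordinate
all vanish has integral zero. -/
theorem integral_eq_zero_of_coordinate_moments_eq_zero {ι : Type*} [Fintype ι]
    {φ : EuclideanSpace ℝ ι → ℝ} (hc : Continuous φ) (hs : HasCompactSupport φ) (i : ι)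
    (hm : ∀ n : ℕ, n ≠ 0 → ∫ x : EuclideanSpace ℝ ι, x i ^ n * φ x = 0) :
    ∫ x, φ x = 0 := by
  obtain ⟨R, hR, hsupp⟩ := hs.isCompact.isBounded.exists_pos_norm_le
  have hbound (x : EuclideanSpace ℝ ι) (hx : φ x ≠ 0) : (x i / R) ^ 2 ≤ 1 := by
    rw [sq_le_one_iff_abs_le_one, abs_div, abs_of_pos hR, div_le_one hR]
    exact (PiLp.norm_apply_le x i).trans (hsupp x (subset_tsupport φ hx))
  have hmass (n : ℕ) :
      ∫ x : EuclideanSpace ℝ ι, (1 - (x i / R) ^ 2) ^ n * φ x = ∫ x, φ x := by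
    obtain ⟨p, hp⟩ : ∃ p : Polynomial ℝ, ∀ t, p.eval t = (1 - (t / R) ^ 2) ^ n :=
      ⟨(1 - (Polynomial.C R⁻¹ * Polynomial.X) ^ 2) ^ n, fun t => by simp [inv_mul_eq_div]⟩
    simpa [hp] using integral_polynomial_eval_apply_mul hc hs i hm p
  have hlim : Tendsto (fun n : ℕ => ∫ x : EuclideanSpace ℝ ι, (1 - (x i / R) ^ 2) ^ n * φ x)
      atTop (𝓝 (∫ _ : EuclideanSpace ℝ ι, (0 : ℝ))) := by
    refine tendsto_integral_of_dominated_convergence (fun x => ‖φ x‖)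
      (fun n => Continuous.aestronglyMeasurable (by fun_prop))
      (hc.integrable_of_hasCompactSupport hs).norm (fun n => .of_forall fun x => ?_) ?_
    · rcases eq_or_ne (φ x) 0 with hx | hx
      · simp [hx]
      · rw [norm_mul, norm_pow]
        refine mul_le_of_le_one_left (norm_nonneg _) (pow_le_one₀ (norm_nonneg _) ?_)
        rw [Real.norm_eq_abs, abs_le]
        constructor <;> linarith [hbound x hx, sq_nonneg (x i / R)]
    · filter_upwards [EuclideanSpace.ae_apply_ne_zero i] with x hxi
      rcases eq_or_ne (φ x) 0 with hx | hx
      · simp [hx]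
      · have hpos : 0 < (x i / R) ^ 2 := by positivity
        simpa using (tendsto_pow_atTop_nhds_zero_of_lt_one
          (by linarith [hbound x hx] : 0 ≤ 1 - (x i / R) ^ 2) (by linarith)).mul_const (φ x)
  simp only [hmass, integral_zero] at hlim
  exact tendsto_nhds_unique tendsto_const_nhds hlim

/-- No compactly supported smooth function on `ℝᵈ` (d ≥ 1) has integral `1` and all
higher moments equal to zero; in particular the intersection of all basic sets `𝓑ₙ`
is empty. -/
theorem basic_sets_empty_intersection (d : ℕ) (hd : 1 ≤ d) :
    ¬ ∃ φ : EuclideanSpace ℝ (Fin d) → ℝ,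
      ContDiff ℝ (⊤ : ℕ∞) φ ∧ HasCompactSupport φ ∧
      (∫ x, φ x) = 1 ∧
      (∀ α : Fin d → ℕ, 1 ≤ ∑ i, α i →
        (∫ x : EuclideanSpace ℝ (Fin d), (∏ i, x i ^ α i) * φ x) = 0) := by
  rintro ⟨φ, hφ, hs, h1, hm⟩
  refine one_ne_zero (h1.symm.trans
    (integral_eq_zero_of_coordinate_moments_eq_zero hφ.continuous hs ⟨0, hd⟩ fun n hn => ?_))
  simpa [Pi.single_apply, pow_ite] using hm (Pi.single ⟨0, hd⟩ n)
    (by simpa [Finset.sum_pi_single'] using Nat.one_le_iff_ne_zero.2 hn)
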